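/- There exists a continuous bijection Φ : ℤ^ℕ → I^ω from the Baire space ℤ^ℕ onto the Hilbert cube which is semi-open (the image of every nonempty open set has nonempty interior) and such that for every f ∈ ℤ^ℕ the set Φ(f + (ℤ \ {0})^ℕ) belongs to the σ-ideal σC₀, where f + (ℤ \ {0})^ℕ = {f + g : g ∈ ℤ^ℕ, g(n) ≠ 0 for all n} with coordinatewise addition. -/

import Mathlib

open Set Topology Cardinal

/-- The Hilbert cube `[0,1]^ℕ` with the product topology. -/
abbrev HilbertCube : Type := ℕ → ↥(Set.Icc (0:ℝ) 1)

/-- An ideal of subsets: a nonempty family closed under subsets and finite unions. -/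
def IsIdeal {X : Type*} (I : Set (Set X)) : Prop :=
  I.Nonempty ∧ (∀ A ∈ I, ∀ B, B ⊆ A → B ∈ I) ∧ (∀ A ∈ I, ∀ B ∈ I, A ∪ B ∈ I)

/-- A σ-ideal: an ideal closed under countable unions. -/
def IsSigmaIdeal {X : Type*} (I : Set (Set X)) : Prop :=
  IsIdeal I ∧ ∀ A : ℕ → Set X, (∀ n, A n ∈ I) → (⋃ n, A n) ∈ I

/-- A non-trivial ideal contains an uncountable set but not the whole space. -/
def NontrivialIdeal {X : Type*} (I : Set (Set X)) : Prop :=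
  (∃ A ∈ I, ¬ A.Countable) ∧ Set.univ ∉ I

/-- An ideal on a topological space is topologically invariant if it is preserved by
all homeomorphisms of the space. -/
def TopInvariant {X : Type*} [TopologicalSpace X] (I : Set (Set X)) : Prop :=
  ∀ h : X ≃ₜ X, {B | ∃ A ∈ I, B = h '' A} = I

/-- `I` has a base all of whose members satisfy `P`. -/
def HasBaseWith {X : Type*} (I : Set (Set X)) (P : Set X → Prop) : Prop :=
  ∃ B ⊆ I, (∀ A ∈ I, ∃ C ∈ B, A ⊆ C) ∧ ∀ C ∈ B, P C

/-- A set has the Baire property if it differs from some open set by a meager set. -/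
def HasBaireProperty {X : Type*} [TopologicalSpace X] (A : Set X) : Prop :=
  ∃ U : Set X, IsOpen U ∧ IsMeagre ((A \ U) ∪ (U \ A))

/-- The σ-ideal of meager subsets of a topological space. -/
def MeagerIdeal (X : Type*) [TopologicalSpace X] : Set (Set X) := {A | IsMeagre A}

/-- The σ-ideal generated by a family `F`: all subsets of countable unions of members
of `F`. -/
def sigmaGenerated {X : Type*} (F : Set (Set X)) : Set (Set X) :=
  {A | ∃ S : ℕ → Set X, (∀ n, S n ∈ F) ∧ A ⊆ ⋃ n, S n}

/-- A Cantor set in the Hilbert cube: a subset homeomorphic to the Cantor cube. -/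
def IsCantorSet (C : Set HilbertCube) : Prop := Nonempty (C ≃ₜ (ℕ → Bool))

/-- A minimal Cantor set: one that can be mapped into any other Cantor set by an
ambient homeomorphism. -/
def IsMinimalCantorSet (A : Set HilbertCube) : Prop :=
  IsCantorSet A ∧ ∀ B : Set HilbertCube, IsCantorSet B →
    ∃ h : HilbertCube ≃ₜ HilbertCube, h '' A ⊆ B

/-- The family of all minimal Cantor sets in the Hilbert cube. -/
def CantorFamily : Set (Set HilbertCube) := {A | IsMinimalCantorSet A}

/-- The σ-ideal generated by minimal Cantor sets. -/
def sigmaC0 : Set (Set HilbertCube) := sigmaGenerated CantorFamily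

/-- A minimal dense Gδ-subset of the Hilbert cube. -/
def IsMinimalDenseGdelta (A : Set HilbertCube) : Prop :=
  IsGδ A ∧ Dense A ∧ ∀ B : Set HilbertCube, IsGδ B → Dense B →
    ∃ h : HilbertCube ≃ₜ HilbertCube, h '' A ⊆ B

/-- The family of all minimal dense Gδ-sets in the Hilbert cube. -/
def GdeltaFamily : Set (Set HilbertCube) := {A | IsMinimalDenseGdelta A}

/-- The σ-ideal generated by minimal dense Gδ-sets. -/
def sigmaG0 : Set (Set HilbertCube) := sigmaGenerated GdeltaFamily

/-- `cov(I)`: the least cardinality of a subfamily of `I` covering the space. -/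
noncomputable def covIdeal {X : Type*} (I : Set (Set X)) : Cardinal :=
  sInf {c | ∃ A : Set (Set X), A ⊆ I ∧ ⋃₀ A = Set.univ ∧ c = #A}

/-- `non(I)`: the least cardinality of a subset of the space not in `I`. -/
noncomputable def nonIdeal {X : Type*} (I : Set (Set X)) : Cardinal :=
  sInf {c | ∃ A : Set X, A ∉ I ∧ c = #A}

/-- `add(I,J)`: the least cardinality of a subfamily of `I` whose union is not in `J`. -/
noncomputable def addIdeal2 {X : Type*} (I J : Set (Set X)) : Cardinal :=
  sInf {c | ∃ A : Set (Set X), A ⊆ I ∧ ⋃₀ A ∉ J ∧ c = #A}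

/-- `add(I) = add(I,I)`. -/
noncomputable def addIdeal {X : Type*} (I : Set (Set X)) : Cardinal := addIdeal2 I I

/-- `cof(I,J)`: the least cardinality of a subfamily of `J` cofinal in `I`. -/
noncomputable def cofIdeal2 {X : Type*} (I J : Set (Set X)) : Cardinal :=
  sInf {c | ∃ A : Set (Set X), A ⊆ J ∧ (∀ B ∈ I, ∃ C ∈ A, B ⊆ C) ∧ c = #A}

/-- `cof(I) = cof(I,I)`. -/
noncomputable def cofIdeal {X : Type*} (I : Set (Set X)) : Cardinal := cofIdeal2 I I

/-- The compact-open topology on the homeomorphism group of a space, induced by the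
compact-open topology of the space of continuous self-maps. -/
noncomputable instance homeoGroupTopology (X : Type*) [TopologicalSpace X] :
    TopologicalSpace (X ≃ₜ X) :=
  TopologicalSpace.induced (fun h : X ≃ₜ X => (⟨h, h.continuous⟩ : C(X, X)))
    ContinuousMap.compactOpen

/-- A Z-set: a closed set `A` such that for every open cover `U` of the space there is a
continuous map into the complement of `A` which is `U`-near to the identity. -/
def IsZSet {X : Type*} [TopologicalSpace X] (A : Set X) : Prop :=
  IsClosed A ∧ ∀ U : Set (Set X), (∀ V ∈ U, IsOpen V) → ⋃₀ U = Set.univ →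
    ∃ f : C(X, X), (∀ x, f x ∉ A) ∧ ∀ x : X, ∃ V ∈ U, x ∈ V ∧ f x ∈ V

/-- A σZ-set: a countable union of Z-sets. -/
def IsSigmaZSet {X : Type*} [TopologicalSpace X] (A : Set X) : Prop :=
  ∃ Z : ℕ → Set X, (∀ n, IsZSet (Z n)) ∧ A = ⋃ n, Z n

/-- The cube `[0,1]^n`. -/
abbrev FinCube (n : ℕ) : Type := Fin n → ↥(Set.Icc (0:ℝ) 1)

/-- A `Z_n`-set in the Hilbert cube: a closed set `A` such that maps avoiding `A` are
dense in the space `C([0,1]^n, I^ω)` with the compact-open topology. -/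
def IsZnSet (n : ℕ) (A : Set HilbertCube) : Prop :=
  IsClosed A ∧ Dense {f : C(FinCube n, HilbertCube) | ∀ x, f x ∉ A}

/-- A `Z_ω`-set in the Hilbert cube: a closed set which is a `Z_n`-set for all `n`. -/
def IsZomegaSet (A : Set HilbertCube) : Prop :=
  IsClosed A ∧ ∀ n : ℕ, IsZnSet n A

/-- Covering dimension of a space is at most `n`: every finite open cover has a finite
open refinement (still a cover) in which no point belongs to more than `n+1` members. -/
def CovDimLE (Y : Type*) [TopologicalSpace Y] (n : ℕ) : Prop :=
  ∀ U : Set (Set Y), U.Finite → (∀ V ∈ U, IsOpen V) → ⋃₀ U = Set.univ →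
    ∃ V : Set (Set Y), V.Finite ∧ (∀ W ∈ V, IsOpen W) ∧ ⋃₀ V = Set.univ ∧
      (∀ W ∈ V, ∃ W' ∈ U, W ⊆ W') ∧
      ∀ y : Y, {W ∈ V | y ∈ W}.ncard ≤ n + 1

/-- A `G_δ`-generated topologically invariant ideal on the Hilbert cube. -/
def GdeltaGenerated (I : Set (Set HilbertCube)) : Prop :=
  HasBaseWith I IsSigmaCompact ∧
  ∃ G : Set HilbertCube, IsGδ G ∧
    (∀ K : Set HilbertCube, K ⊆ G → IsCompact K → K ∈ I) ∧
    ∀ A ∈ I, IsCompact A →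
      Dense {h : HilbertCube ≃ₜ HilbertCube | h '' A ⊆ G}

/-- A `G_δ*`-generated ideal: a preimage of a `G_δ`-generated ideal under an embedding. -/
def GdeltaStarGenerated (I : Set (Set HilbertCube)) : Prop :=
  ∃ I' : Set (Set HilbertCube), GdeltaGenerated I' ∧
    ∃ e : HilbertCube → HilbertCube, IsEmbedding e ∧ I = {S | ∃ A ∈ I', S = e ⁻¹' A}

/-- A `σG_δ*`-generated ideal. -/
def SigmaGdeltaStarGenerated (I : Set (Set HilbertCube)) : Prop :=
  ∃ In : ℕ → Set (Set HilbertCube), (∀ n, GdeltaStarGenerated (In n)) ∧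
    (∀ n, In n ⊆ I) ∧
    ∀ A ∈ I, ∃ K : ℕ → Set HilbertCube,
      (∀ n, IsCompact (K n) ∧ K n ∈ In n) ∧ A ⊆ ⋃ n, K n

/-- The left end `b - (b - a) / 2 ^ k` of the `k`-th piece of the dyadic partition of
`[a, b)`. -/
noncomputable def dyadicEnd (a b : ℝ) (k : ℕ) : ℝ := b - (b - a) / 2 ^ k

theorem dyadicEnd_zero (a b : ℝ) : dyadicEnd a b 0 = a := by simp [dyadicEnd]

theorem dyadicEnd_strictMono {a b : ℝ} (h : a < b) : StrictMono (dyadicEnd a b) := by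
  refine strictMono_nat_of_lt_succ fun k => ?_
  have h2 : (b - a) / 2 ^ k = 2 * ((b - a) / 2 ^ (k + 1)) := by field_simp; ring
  have h3 : 0 < (b - a) / 2 ^ (k + 1) := div_pos (sub_pos.2 h) (by positivity)
  simp only [dyadicEnd]
  linarith

theorem dyadicEnd_lt {a b : ℝ} (h : a < b) (k : ℕ) : dyadicEnd a b k < b := by
  have h3 : 0 < (b - a) / 2 ^ k := div_pos (sub_pos.2 h) (by positivity)
  simp only [dyadicEnd]
  linarith

theorem le_dyadicEnd {a b : ℝ} (h : a < b) (k : ℕ) : a ≤ dyadicEnd a b k := by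
  simpa [dyadicEnd_zero] using (dyadicEnd_strictMono h).monotone (Nat.zero_le k)

theorem dyadicEnd_succ_sub_le {a b : ℝ} (h : a < b) (k : ℕ) :
    dyadicEnd a b (k + 1) - dyadicEnd a b k ≤ (b - a) / 2 := by
  have h1 : dyadicEnd a b (k + 1) - dyadicEnd a b k = (b - a) / 2 / 2 ^ k := by
    simp only [dyadicEnd]; field_simp; ring
  rw [h1]
  exact div_le_self (by linarith) (one_le_pow₀ (by norm_num))

theorem exists_mem_dyadic {a b y : ℝ} (hy : y ∈ Ico a b) :
    ∃ k, y ∈ Ico (dyadicEnd a b k) (dyadicEnd a b (k + 1)) := by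
  have h : a < b := hy.1.trans_lt hy.2
  have hex : ∃ k, y < dyadicEnd a b k := by
    obtain ⟨k, hk⟩ := exists_pow_lt_of_lt_one (div_pos (sub_pos.2 hy.2) (sub_pos.2 h))
      (by norm_num : (1 / 2 : ℝ) < 1)
    refine ⟨k, ?_⟩
    rw [lt_div_iff₀ (sub_pos.2 h)] at hk
    have : (b - a) / 2 ^ k = (1 / 2) ^ k * (b - a) := by rw [one_div_pow]; ring
    simp only [dyadicEnd]
    linarith
  classical
  obtain ⟨k, hk⟩ : ∃ k, Nat.find hex = k + 1 := by
    refine Nat.exists_eq_succ_of_ne_zero fun h0 => ?_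
    have := Nat.find_spec hex
    rw [h0, dyadicEnd_zero] at this
    exact absurd hy.1 (not_le.2 this)
  refine ⟨k, not_lt.1 (Nat.find_min hex (by omega)), ?_⟩
  rw [← hk]
  exact Nat.find_spec hex

/-- A scheme of intervals, given by endpoints and a flag saying whether the interval is closed.
A half-open interval is cut dyadically; a closed one is cut into its closed right half
and the dyadic pieces of its left half. -/
noncomputable def intervalData : List ℕ → ℝ × ℝ × Bool
  | [] => (0, 1, true)
  | k :: l =>
    match intervalData l, k with
    | (a, b, true), 0 => ((a + b) / 2, b, true)
    | (a, b, true), k + 1 =>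
      (dyadicEnd a ((a + b) / 2) k, dyadicEnd a ((a + b) / 2) (k + 1), false)
    | (a, b, false), k => (dyadicEnd a b k, dyadicEnd a b (k + 1), false)

/-- The interval encoded by endpoints and a flag. -/
def flagInterval (d : ℝ × ℝ × Bool) : Set ℝ := if d.2.2 then Icc d.1 d.2.1 else Ico d.1 d.2.1

theorem Ioo_subset_flagInterval (d : ℝ × ℝ × Bool) : Ioo d.1 d.2.1 ⊆ flagInterval d := by
  unfold flagInterval
  split_ifs
  exacts [Ioo_subset_Icc_self, Ioo_subset_Ico_self]

theorem flagInterval_subset_Icc (d : ℝ × ℝ × Bool) : flagInterval d ⊆ Icc d.1 d.2.1 := by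
  unfold flagInterval
  split_ifs
  exacts [subset_rfl, Ico_subset_Icc_self]

theorem intervalData_lt (l : List ℕ) : (intervalData l).1 < (intervalData l).2.1 := by
  induction l with
  | nil => simp [intervalData]
  | cons k l ih =>
    rcases h : intervalData l with ⟨a, b, _ | _⟩ <;> rw [h] at ih
    · simpa [intervalData, h] using dyadicEnd_strictMono ih k.lt_succ_self
    · have h2 : a < (a + b) / 2 := by simp only at ih; linarith
      rcases k with _ | k
      · simp only [intervalData, h]; linarith
      · simpa [intervalData, h] using dyadicEnd_strictMono h2 k.lt_succ_self

theorem intervalData_length_le (l : List ℕ) :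
    (intervalData l).2.1 - (intervalData l).1 ≤ 1 / 2 ^ l.length := by
  induction l with
  | nil => simp [intervalData]
  | cons k l ih =>
    have hlt := intervalData_lt l
    have h3 : (1 : ℝ) / 2 ^ (k :: l).length = 1 / 2 ^ l.length / 2 := by
      rw [List.length_cons, pow_succ]; field_simp
    rw [h3]
    rcases h : intervalData l with ⟨a, b, _ | _⟩ <;> rw [h] at ih hlt <;> simp only at ih hlt
    · have := dyadicEnd_succ_sub_le hlt k
      simp only [intervalData, h]
      linarith
    · have h2 : a < (a + b) / 2 := by linarith
      rcases k with _ | k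
      · simp only [intervalData, h]; linarith
      · have := dyadicEnd_succ_sub_le h2 k
        simp only [intervalData, h]; linarith

theorem closure_flagInterval_cons_subset (l : List ℕ) (k : ℕ) :
    closure (flagInterval (intervalData (k :: l))) ⊆ flagInterval (intervalData l) := by
  refine (closure_minimal (flagInterval_subset_Icc _) isClosed_Icc).trans ?_
  have hlt := intervalData_lt l
  rcases h : intervalData l with ⟨a, b, _ | _⟩ <;> rw [h] at hlt <;> simp only at hlt
  · simp only [intervalData, h, flagInterval]
    exact fun y hy => ⟨(le_dyadicEnd hlt k).trans hy.1, hy.2.trans_lt (dyadicEnd_lt hlt _)⟩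
  · have h2 : a < (a + b) / 2 := by linarith
    rcases k with _ | k <;> simp only [intervalData, h, flagInterval]
    · exact fun y hy => ⟨by linarith [hy.1], hy.2⟩
    · exact fun y hy => ⟨(le_dyadicEnd h2 k).trans hy.1,
        by linarith [hy.2.trans_lt (dyadicEnd_lt h2 _)]⟩

theorem disjoint_Ico_dyadic {a b : ℝ} (h : a < b) {j k : ℕ} (hjk : j ≠ k) :
    Disjoint (Ico (dyadicEnd a b j) (dyadicEnd a b (j + 1)))
      (Ico (dyadicEnd a b k) (dyadicEnd a b (k + 1))) :=
  (dyadicEnd_strictMono h).monotone.pairwise_disjoint_on_Ico_succ hjk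

theorem disjoint_flagInterval_cons (l : List ℕ) {j k : ℕ} (hjk : j ≠ k) :
    Disjoint (flagInterval (intervalData (j :: l))) (flagInterval (intervalData (k :: l))) := by
  have hlt := intervalData_lt l
  rcases h : intervalData l with ⟨a, b, _ | _⟩ <;> rw [h] at hlt <;> simp only at hlt
  · simpa [intervalData, h, flagInterval] using disjoint_Ico_dyadic hlt hjk
  · have h2 : a < (a + b) / 2 := by linarith
    rcases j with _ | j <;> rcases k with _ | k
    · exact absurd rfl hjk
    · simp only [intervalData, h, flagInterval]
      refine Set.disjoint_left.2 fun y hy hy' => ?_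
      have h3 := hy'.2.trans (dyadicEnd_lt h2 _)
      exact absurd hy.1 (not_le.2 h3)
    · simp only [intervalData, h, flagInterval]
      refine Set.disjoint_left.2 fun y hy' hy => ?_
      have h3 := hy'.2.trans (dyadicEnd_lt h2 _)
      exact absurd hy.1 (not_le.2 h3)
    · simpa [intervalData, h, flagInterval] using disjoint_Ico_dyadic h2 (fun e => hjk (by rw [e]))

theorem exists_mem_flagInterval_cons {l : List ℕ} {y : ℝ}
    (hy : y ∈ flagInterval (intervalData l)) :
    ∃ k, y ∈ flagInterval (intervalData (k :: l)) := by
  rcases h : intervalData l with ⟨a, b, _ | _⟩ <;> rw [h] at hy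
  · obtain ⟨k, hk⟩ := exists_mem_dyadic (by simpa [flagInterval] using hy)
    exact ⟨k, by simpa [intervalData, h, flagInterval] using hk⟩
  · simp only [flagInterval, if_true] at hy
    rcases lt_or_ge y ((a + b) / 2) with h1 | h1
    · obtain ⟨k, hk⟩ := exists_mem_dyadic (show y ∈ Ico a ((a + b) / 2) from ⟨hy.1, h1⟩)
      exact ⟨k + 1, by simpa [intervalData, h, flagInterval] using hk⟩
    · exact ⟨0, by simpa [intervalData, h, flagInterval] using ⟨h1, hy.2⟩⟩

open PiNat in
theorem exists_semiopen_bijection_nat_seq :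
    ∃ φ : (ℕ → ℕ) → ↥(Icc (0 : ℝ) 1), Continuous φ ∧ Function.Bijective φ ∧
      ∀ U : Set (ℕ → ℕ), IsOpen U → U.Nonempty → (interior (φ '' U)).Nonempty := by
  set A : List ℕ → Set ℝ := fun l => flagInterval (intervalData l) with hA
  have hanti : CantorScheme.ClosureAntitone A := closure_flagInterval_cons_subset
  have hdisj : CantorScheme.Disjoint A := fun l _ _ h => disjoint_flagInterval_cons l h
  have hbound : ∀ l, Metric.ediam (A l) ≤ ENNReal.ofReal (1 / 2 ^ l.length) := fun l => by
    refine (Metric.ediam_mono (flagInterval_subset_Icc _)).trans ?_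
    rw [Real.ediam_Icc]
    exact ENNReal.ofReal_le_ofReal (intervalData_length_le l)
  have hdiam : CantorScheme.VanishingDiam A := fun x => by
    refine tendsto_of_tendsto_of_tendsto_of_le_of_le tendsto_const_nhds
      (h := fun n => ENNReal.ofReal ((1 / 2) ^ n)) ?_ (fun _ => zero_le) fun n => ?_
    · have := ENNReal.tendsto_ofReal
        (tendsto_pow_atTop_nhds_zero_of_lt_one (r := (1 / 2 : ℝ)) (by norm_num) (by norm_num))
      simpa using this
    · simpa [one_div_pow] using hbound (res x n)
  have hne : ∀ l, (A l).Nonempty := fun l =>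
    (nonempty_Ioo.2 (intervalData_lt l)).mono (Ioo_subset_flagInterval _)
  have huniv := hanti.map_of_vanishingDiam hdiam hne
  set ψ : (ℕ → ℕ) → ℝ := fun x => (CantorScheme.inducedMap A).2 ⟨x, huniv ▸ mem_univ x⟩ with hψ
  have hmem : ∀ x n, ψ x ∈ A (res x n) := fun x n => CantorScheme.map_mem _ n
  have hψc : Continuous ψ := hdiam.map_continuous.comp (by fun_prop)
  have hψi : Function.Injective ψ := fun x y h => by
    simpa using hdisj.map_injective h
  have hroot : A [] = Icc 0 1 := by simp [hA, intervalData, flagInterval]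
  have hsurj : ∀ z n y, y ∈ A (res z n) → ∃ x ∈ cylinder z n, ψ x = y := by
    intro z n y hy
    choose! g hg using fun l (h : y ∈ A l) => exists_mem_flagInterval_cons h
    let w : ℕ → List ℕ := fun m => Nat.rec (res z n) (fun _ l => g l :: l) m
    have hw : ∀ m, y ∈ A (w m) := fun m => by
      induction m with
      | zero => exact hy
      | succ m ih => exact hg _ ih
    let x : ℕ → ℕ := fun m => if m < n then z m else g (w (m - n))
    have hx : ∀ m, res x (n + m) = w m := fun m => by
      induction m with
      | zero =>
        refine res_eq_res.2 fun i hi => ?_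
        simp only [add_zero] at hi
        simp [x, hi]
      | succ m ih =>
        rw [← add_assoc, res_succ, ih]
        simp [x, w]
    refine ⟨x, fun i hi => by simp [x, hi], ?_⟩
    by_contra hxy
    obtain ⟨m, hm⟩ := hdiam.dist_lt (dist (ψ x) y) (dist_pos.2 hxy) x
    have hle : ∀ k, A (res x (m + k)) ⊆ A (res x m) := fun k => by
      induction k with
      | zero => exact subset_rfl
      | succ k ih => exact (hanti.antitone _ _).trans ih
    refine lt_irrefl _ (hm (ψ x) (hmem x m) y (hle n ?_))
    rw [add_comm, hx]
    exact hw m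
  refine ⟨fun x => ⟨ψ x, hroot ▸ hmem x 0⟩, hψc.subtype_mk _,
    ⟨fun x y h => hψi (congrArg Subtype.val h), fun y => ?_⟩, fun U hU hUne => ?_⟩
  · obtain ⟨x, -, hx⟩ := hsurj 0 0 y (by simp [hroot])
    exact ⟨x, Subtype.ext hx⟩
  · obtain ⟨z, hz⟩ := hUne
    obtain ⟨n, hn⟩ : ∃ n, cylinder z n ⊆ U := by
      obtain ⟨_, ⟨x, n, rfl⟩, hzx, hxU⟩ :=
        (isTopologicalBasis_cylinders (fun _ : ℕ => ℕ)).exists_subset_of_mem_open hz hU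
      exact ⟨n, by rwa [mem_cylinder_iff_eq.1 hzx]⟩
    set d := intervalData (res z n) with hd
    refine Set.Nonempty.mono (s := Subtype.val ⁻¹' Ioo d.1 d.2.1) ?_ ?_
    · refine interior_maximal ?_ (isOpen_Ioo.preimage continuous_subtype_val)
      intro y hy
      obtain ⟨x, hx, hxy⟩ := hsurj z n y (Ioo_subset_flagInterval _ hy)
      exact ⟨x, hn hx, Subtype.ext hxy⟩
    · obtain ⟨y, hy⟩ := nonempty_Ioo.2 (intervalData_lt (res z n))
      obtain ⟨x, -, hxy⟩ := hsurj z n y (Ioo_subset_flagInterval _ hy)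
      exact ⟨⟨y, hxy ▸ hroot ▸ hmem x 0⟩, hy⟩

theorem exists_semiopen_bijection_int_seq :
    ∃ φ : (ℕ → ℤ) → ↥(Icc (0 : ℝ) 1), Continuous φ ∧ Function.Bijective φ ∧
      ∀ U : Set (ℕ → ℤ), IsOpen U → U.Nonempty → (interior (φ '' U)).Nonempty := by
  obtain ⟨φ, hc, hb, ho⟩ := exists_semiopen_bijection_nat_seq
  let E : (ℕ → ℤ) ≃ₜ (ℕ → ℕ) := Homeomorph.piCongrRight fun _ =>
    Equiv.intEquivNat.toHomeomorphOfDiscrete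
  refine ⟨φ ∘ E, hc.comp E.continuous, hb.comp E.bijective, fun U hU hne => ?_⟩
  rw [image_comp]
  exact ho _ (E.isOpenMap _ hU) (hne.image _)

/-- The pseudo-interior of the Hilbert cube. -/
def pseudoInterior : Set HilbertCube := {x | ∀ i, (x i : ℝ) ∈ Ioo 0 1}

/-- The self-map `y ↦ y ^ exp t` of the unit interval. -/
noncomputable def powMap (t : ℝ) (y : ↥(Icc (0:ℝ) 1)) : ↥(Icc (0:ℝ) 1) :=
  ⟨(y : ℝ) ^ Real.exp t, Real.rpow_nonneg y.2.1 _,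
    Real.rpow_le_one y.2.1 y.2.2 (Real.exp_pos t).le⟩

theorem powMap_neg_powMap (t : ℝ) (y : ↥(Icc (0:ℝ) 1)) : powMap (-t) (powMap t y) = y := by
  ext
  simp only [powMap]
  rw [← Real.rpow_mul y.2.1, ← Real.exp_add]
  simp

theorem continuous_powMap : Continuous fun p : ℝ × ↥(Icc (0:ℝ) 1) => powMap p.1 p.2 := by
  refine Continuous.subtype_mk ?_ _
  exact (continuous_subtype_val.comp continuous_snd).rpow (Real.continuous_exp.comp continuous_fst)
    fun p => Or.inr (Real.exp_pos _)

/-- The coordinate on `(0, 1)` in which `powMap` acts by translations. -/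
noncomputable def logLog (y : ↥(Icc (0:ℝ) 1)) : ℝ := Real.log (-Real.log y)

theorem exp_neg_exp_logLog {y : ↥(Icc (0:ℝ) 1)} (hy : (y : ℝ) ∈ Ioo 0 1) :
    Real.exp (-Real.exp (logLog y)) = y := by
  rw [logLog, Real.exp_log (neg_pos.2 (Real.log_neg hy.1 hy.2)), neg_neg, Real.exp_log hy.1]

theorem powMap_mem_Ioo (t : ℝ) {y : ↥(Icc (0:ℝ) 1)} (hy : (y : ℝ) ∈ Ioo 0 1) :
    (powMap t y : ℝ) ∈ Ioo 0 1 :=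
  ⟨Real.rpow_pos_of_pos hy.1 _, Real.rpow_lt_one hy.1.le hy.2 (Real.exp_pos t)⟩

theorem logLog_powMap (t : ℝ) {y : ↥(Icc (0:ℝ) 1)} (hy : (y : ℝ) ∈ Ioo 0 1) :
    logLog (powMap t y) = logLog y + t := by
  have h := Real.log_neg hy.1 hy.2
  simp only [logLog, powMap]
  rw [Real.log_rpow hy.1, ← mul_neg, Real.log_mul (Real.exp_pos t).ne' (neg_pos.2 h).ne',
    Real.log_exp, add_comm]

theorem logLog_injOn {y z : ↥(Icc (0:ℝ) 1)} (hy : (y : ℝ) ∈ Ioo 0 1) (hz : (z : ℝ) ∈ Ioo 0 1)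
    (h : logLog y = logLog z) : y = z := by
  ext
  rw [← exp_neg_exp_logLog hy, ← exp_neg_exp_logLog hz, h]

theorem continuous_logLog_comp {K : Type*} [TopologicalSpace K] {f : K → ↥(Icc (0:ℝ) 1)}
    (hf : Continuous f) (h : ∀ k, (f k : ℝ) ∈ Ioo 0 1) : Continuous fun k => logLog (f k) := by
  have h1 : Continuous fun k => Real.log (f k : ℝ) :=
    (continuous_subtype_val.comp hf).log fun k => (h k).1.ne'
  exact h1.neg.log fun k => (neg_pos.2 (Real.log_neg (h k).1 (h k).2)).ne'

/-- The homeomorphism of `X × I^ω` over `X` acting by `powMap` on every coordinate. -/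
noncomputable def fiberHomeo {X : Type*} [TopologicalSpace X] (t : C(X, ℕ → ℝ)) :
    X × HilbertCube ≃ₜ X × HilbertCube where
  toFun p := (p.1, fun i => powMap (t p.1 i) (p.2 i))
  invFun p := (p.1, fun i => powMap (-t p.1 i) (p.2 i))
  left_inv p := by simp [powMap_neg_powMap]
  right_inv p := by
    have h : ∀ s y, powMap s (powMap (-s) y) = y := fun s y => by
      simpa using powMap_neg_powMap (-s) y
    simp [h]
  continuous_toFun := continuous_fst.prodMk <| continuous_pi fun i =>
    continuous_powMap.comp (f := fun p : X × HilbertCube => (t p.1 i, p.2 i)) (by fun_prop)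
  continuous_invFun := continuous_fst.prodMk <| continuous_pi fun i =>
    continuous_powMap.comp (f := fun p : X × HilbertCube => (-t p.1 i, p.2 i)) (by fun_prop)

/-- Every translation function on an embedded compact set extends to a fiberwise
homeomorphism. -/
theorem exists_fiberHomeo {K : Type*} [TopologicalSpace K] [CompactSpace K]
    {a : K → HilbertCube} (ha : Continuous a) (hinj : Function.Injective a)
    {t : K → ℕ → ℝ} (ht : Continuous t) :
    ∃ h : HilbertCube × HilbertCube ≃ₜ HilbertCube × HilbertCube,
      ∀ k y, h (a k, y) = (a k, fun i => powMap (t k i) (y i)) := by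
  obtain ⟨g, hg⟩ := ContinuousMap.exists_extension' (ha.isClosedEmbedding hinj) ⟨t, ht⟩
  refine ⟨fiberHomeo g, fun k y => ?_⟩
  have : g (a k) = t k := congrFun hg k
  simp [fiberHomeo, this]

/-- Over an embedded compact set, one can move any pseudo-interior graph to any other. -/
theorem exists_homeo_graph_to_graph {K : Type*} [TopologicalSpace K] [CompactSpace K]
    {a c d : K → HilbertCube} (ha : Continuous a) (hinj : Function.Injective a)
    (hc : Continuous c) (hd : Continuous d) (hci : ∀ k, c k ∈ pseudoInterior)
    (hdi : ∀ k, d k ∈ pseudoInterior) :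
    ∃ h : HilbertCube × HilbertCube ≃ₜ HilbertCube × HilbertCube,
      ∀ k, h (a k, c k) = (a k, d k) := by
  obtain ⟨h, hh⟩ := exists_fiberHomeo ha hinj (t := fun k i => logLog (d k i) - logLog (c k i))
    (continuous_pi fun i => (continuous_logLog_comp (by fun_prop) fun k => hdi k i).sub
      (continuous_logLog_comp (by fun_prop) fun k => hci k i))
  refine ⟨h, fun k => ?_⟩
  rw [hh]
  refine Prod.ext rfl (funext fun i => logLog_injOn (powMap_mem_Ioo _ (hci k i)) (hdi k i) ?_)
  rw [logLog_powMap _ (hci k i)]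
  ring

/-- A map into `I^ω × I^ω` is unknotted if it is continuous, takes pseudo-interior values
and is injective already in the first factor. -/
structure IsUnknotted {K : Type*} [TopologicalSpace K] (α : K → HilbertCube × HilbertCube) :
    Prop where
  continuous : Continuous α
  fst_mem : ∀ k, (α k).1 ∈ pseudoInterior
  snd_mem : ∀ k, (α k).2 ∈ pseudoInterior
  injective_fst : Function.Injective fun k => (α k).1

/-- Any two unknotted maps of a compact space differ by an ambient homeomorphism. -/
theorem IsUnknotted.exists_homeo {K : Type*} [TopologicalSpace K] [CompactSpace K]
    {α β : K → HilbertCube × HilbertCube} (hα : IsUnknotted α) (hβ : IsUnknotted β) :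
    ∃ h : HilbertCube × HilbertCube ≃ₜ HilbertCube × HilbertCube, ∀ k, h (α k) = β k := by
  obtain ⟨h₁, hh₁⟩ := exists_homeo_graph_to_graph hα.continuous.fst hα.injective_fst
    hα.continuous.snd hβ.continuous.fst hα.snd_mem hβ.fst_mem
  obtain ⟨h₂, hh₂⟩ := exists_homeo_graph_to_graph hβ.continuous.fst hβ.injective_fst
    hα.continuous.fst hβ.continuous.snd hα.fst_mem hβ.snd_mem
  refine ⟨(h₁.trans (Homeomorph.prodComm _ _)).trans h₂, fun k => ?_⟩
  have := hh₁ k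
  simp only [Prod.mk.eta] at this
  simp [this, hh₂]

/-- A product of two embeddings into the pseudo-interior becomes unknotted after an ambient
homeomorphism, provided that the second embedded compact set also embeds in the Cantor cube. -/
theorem exists_homeo_isUnknotted_of_bits {K L : Type*} [TopologicalSpace K] [CompactSpace K]
    [TopologicalSpace L] [CompactSpace L] {a : K → HilbertCube} {c : L → HilbertCube}
    (ha : Continuous a) (hai : Function.Injective a) (ham : ∀ k, a k ∈ pseudoInterior)
    (hc : Continuous c) (hci : Function.Injective c) (hcm : ∀ k, c k ∈ pseudoInterior)
    {b : L → ℕ → Bool} (hb : Continuous b) (hbi : Function.Injective b) :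
    ∃ h : HilbertCube × HilbertCube ≃ₜ HilbertCube × HilbertCube,
      IsUnknotted fun p : K × L => h (a p.1, c p.2) := by
  have hbd : ∀ i, ∃ C, ∀ k, |logLog (a k i)| ≤ C := fun i => by
    have hcont : Continuous fun k => |logLog (a k i)| :=
      (continuous_logLog_comp (by fun_prop) fun k => ham k i).abs
    obtain ⟨C, hC⟩ := isCompact_univ.bddAbove_image hcont.continuousOn
    exact ⟨C, fun k => hC ⟨k, mem_univ k, rfl⟩⟩
  choose C hC using hbd
  obtain ⟨h, hh⟩ := exists_fiberHomeo hc hci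
    (t := fun l i => if b l i then 2 * C i + 1 else 0)
    (continuous_pi fun i => (continuous_of_discreteTopology
      (f := fun z : Bool => if z then 2 * C i + 1 else 0)).comp (by fun_prop))
  refine ⟨((Homeomorph.prodComm _ _).trans h).trans (Homeomorph.prodComm _ _), ?_⟩
  have key : ∀ p : K × L, (((Homeomorph.prodComm _ _).trans h).trans (Homeomorph.prodComm _ _))
      (a p.1, c p.2) = (fun i => powMap (if b p.2 i then 2 * C i + 1 else 0) (a p.1 i), c p.2) :=
    fun p => by simp [hh]
  constructor
  · exact (Homeomorph.continuous _).comp (by fun_prop)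
  · intro p i
    rw [key]
    exact powMap_mem_Ioo _ (ham _ i)
  · intro p
    rw [key]
    exact hcm _
  · intro p q hpq
    simp only [key] at hpq
    have hbits : b p.2 = b q.2 := by
      funext i
      have h1 := congrArg logLog (congrFun hpq i)
      rw [logLog_powMap _ (ham _ i), logLog_powMap _ (ham _ i)] at h1
      have h2 := abs_le.1 (hC i p.1)
      have h3 := abs_le.1 (hC i q.1)
      cases hp : b p.2 i <;> cases hq : b q.2 i <;> simp [hp, hq] at h1 ⊢ <;> linarith
    have h2 : p.2 = q.2 := hbi hbits
    refine Prod.ext (hai (funext fun i => ?_)) h2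
    have h1 := congrArg logLog (congrFun hpq i)
    rw [logLog_powMap _ (ham _ i), logLog_powMap _ (ham _ i), h2] at h1
    exact logLog_injOn (ham _ i) (ham _ i) (by linarith)

/-- The linear map `(u, x) ↦ (u, c x)` of the plane, rescaled radially so as to preserve the
sup norm. -/
noncomputable def radialScale (c : ℝ) (z : ℝ × ℝ) : ℝ × ℝ :=
  (‖z‖ / ‖((z.1, c * z.2) : ℝ × ℝ)‖) • (z.1, c * z.2)

theorem scale_ne_zero {c : ℝ} (hc : c ≠ 0) {z : ℝ × ℝ} (hz : z ≠ 0) :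
    ((z.1, c * z.2) : ℝ × ℝ) ≠ 0 := fun h => by
  rw [Prod.mk_eq_zero, mul_eq_zero] at h
  exact hz (Prod.ext h.1 (h.2.resolve_left hc))

theorem norm_radialScale {c : ℝ} (hc : c ≠ 0) (z : ℝ × ℝ) : ‖radialScale c z‖ = ‖z‖ := by
  rcases eq_or_ne z 0 with rfl | hz
  · simp [radialScale]
  · have h := norm_ne_zero_iff.2 (scale_ne_zero hc hz)
    rw [radialScale, norm_smul, norm_div, norm_norm, norm_norm, div_mul_cancel₀ _ h]

theorem radialScale_inv_radialScale {c : ℝ} (hc : c ≠ 0) (z : ℝ × ℝ) :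
    radialScale c⁻¹ (radialScale c z) = z := by
  rcases eq_or_ne z 0 with rfl | hz
  · simp [radialScale]
  · have hD := norm_ne_zero_iff.2 (scale_ne_zero hc hz)
    have hN := norm_ne_zero_iff.2 hz
    have h1 : (((radialScale c z).1, c⁻¹ * (radialScale c z).2) : ℝ × ℝ) =
        (‖z‖ / ‖((z.1, c * z.2) : ℝ × ℝ)‖) • z := by
      ext
      · simp [radialScale]
      · simp only [radialScale, Prod.smul_snd, smul_eq_mul]
        field_simp
    rw [radialScale, norm_radialScale hc, h1, norm_smul, norm_div, norm_norm, norm_norm, smul_smul]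
    have : ‖z‖ / (‖z‖ / ‖((z.1, c * z.2) : ℝ × ℝ)‖ * ‖z‖) *
        (‖z‖ / ‖((z.1, c * z.2) : ℝ × ℝ)‖) = 1 := by
      field_simp
    rw [this, one_smul]

theorem continuous_radialScale {c : ℝ} (hc : c ≠ 0) : Continuous (radialScale c) := by
  rw [continuous_iff_continuousAt]
  intro z
  rcases eq_or_ne z 0 with rfl | hz
  · have h0 : radialScale c 0 = 0 := by simp [radialScale]
    rw [ContinuousAt, h0, tendsto_zero_iff_norm_tendsto_zero]
    simp only [norm_radialScale hc]
    simpa using (continuous_norm (E := ℝ × ℝ)).tendsto 0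
  · have h := norm_ne_zero_iff.2 (scale_ne_zero hc hz)
    unfold radialScale
    fun_prop (disch := assumption)

theorem abs_mul_max_div_max {δ : ℝ} (hδ : 0 < δ) (hδ1 : δ ≤ 1) (v w : ℝ) :
    |v| * (max |v| |w| / max |v| (δ * |w|)) = max |v| (min |w| (|v| / δ)) := by
  have hv := abs_nonneg v
  have hw := abs_nonneg w
  generalize |v| = V at *
  generalize |w| = W at *
  rcases eq_or_lt_of_le hv with rfl | hv'
  · simp [hw]
  rcases le_total W V with h1 | h1
  · have h2 : δ * W ≤ V := (mul_le_of_le_one_left hw hδ1).trans h1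
    rw [max_eq_left h1, max_eq_left h2, max_eq_left ((min_le_left _ _).trans h1),
      div_self hv'.ne', mul_one]
  · rw [max_eq_right h1]
    rcases le_total (δ * W) V with h2 | h2
    · rw [max_eq_left h2, min_eq_left ((le_div_iff₀ hδ).2 (by linarith)), max_eq_right h1]
      field_simp
    · have hW : 0 < W := hv'.trans_le h1
      rw [max_eq_right h2, min_eq_right ((div_le_iff₀ hδ).2 (by linarith)),
        max_eq_right ((le_div_iff₀ hδ).2 (mul_le_of_le_one_right hv hδ1))]
      field_simp

theorem radialScale_fst (c : ℝ) (hc : 0 < c) (v w : ℝ) :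
    (radialScale c (v, w)).1 = v * (max |v| |w| / max |v| (c * |w|)) := by
  simp only [radialScale, Prod.norm_def, Real.norm_eq_abs, Prod.smul_mk, smul_eq_mul, abs_mul,
    abs_of_pos hc]
  ring

theorem abs_radialScale_fst_sub_le {δ : ℝ} (hδ : 0 < δ) (hδ1 : δ ≤ 1) (v w w' : ℝ) :
    |(radialScale δ (v, w)).1 - (radialScale δ (v, w')).1| =
      |max |v| (min |w| (|v| / δ)) - max |v| (min |w'| (|v| / δ))| := by
  rw [radialScale_fst δ hδ, radialScale_fst δ hδ, ← abs_mul_max_div_max hδ hδ1,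
    ← abs_mul_max_div_max hδ hδ1, ← mul_sub, ← mul_sub, abs_mul, abs_mul, abs_abs]

theorem abs_radialScale_fst_sub_le_abs {δ : ℝ} (hδ : 0 < δ) (hδ1 : δ ≤ 1) (v w w' : ℝ) :
    |(radialScale δ (v, w)).1 - (radialScale δ (v, w')).1| ≤ |w - w'| := by
  rw [abs_radialScale_fst_sub_le hδ hδ1]
  refine le_trans ?_ (abs_abs_sub_abs_le w w')
  rw [max_comm |v|, max_comm |v|]
  refine (abs_max_sub_max_le_abs _ _ _).trans ?_
  simpa using abs_min_sub_min_le_max |w| (|v| / δ) |w'| (|v| / δ)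

theorem abs_radialScale_fst_sub_le_one_sub {δ : ℝ} (hδ : 0 < δ) (hδ1 : δ ≤ 1) {v w w' : ℝ}
    (hw : |w| ≤ 1) (hw' : |w'| ≤ 1) :
    |(radialScale δ (v, w)).1 - (radialScale δ (v, w')).1| ≤ 1 - δ := by
  rw [abs_radialScale_fst_sub_le hδ hδ1]
  have key : ∀ s, |s| ≤ 1 → max |v| (min |s| (|v| / δ)) ≤ |v| + (1 - δ) := fun s hs => by
    refine max_le (by linarith) ?_
    rcases le_total |v| δ with h | h
    · refine (min_le_right _ _).trans ((div_le_iff₀ hδ).2 ?_)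
      nlinarith
    · exact (min_le_left _ _).trans (by linarith)
  rw [abs_sub_le_iff]
  constructor
  · linarith [key w hw, le_max_left |v| (min |w'| (|v| / δ))]
  · linarith [key w' hw', le_max_left |v| (min |w| (|v| / δ))]

theorem abs_radialScale_fst_lt_one {δ : ℝ} (hδ : 0 < δ) {u x : ℝ} (hu : |u| ≤ 1) (hx : |x| ≤ 1)
    (hxδ : δ < |x|) : |(radialScale δ⁻¹ (u, x)).1| < 1 := by
  have hx0 : 0 < |x| := hδ.trans hxδ
  have h1 : 1 < δ⁻¹ * |x| := by rw [inv_mul_eq_div]; exact (one_lt_div hδ).2 hxδ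
  rw [radialScale_fst _ (inv_pos.2 hδ), abs_mul,
    max_eq_right (hu.trans h1.le), abs_div, abs_of_pos (lt_trans one_pos h1),
    abs_of_nonneg (le_max_of_le_left (abs_nonneg u)), ← mul_div_assoc,
    div_lt_one (lt_trans one_pos h1)]
  exact (mul_le_one₀ hu (le_max_of_le_left (abs_nonneg u)) (max_le hu hx)).trans_lt h1

/-- The carried coordinate of the chain of planar maps `radialScale (δ n)⁻¹` acting successively on
the coordinates `(n, n + 1)`. -/
noncomputable def chainCarry (δ : ℕ → ℝ) (x : ℕ → ↥(Icc (-1 : ℝ) 1)) : ℕ → ℝ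
  | 0 => x 0
  | n + 1 => (radialScale (δ n)⁻¹ (chainCarry δ x n, x (n + 1))).2

/-- The output coordinates of the chain of planar maps. -/
noncomputable def chainOut (δ : ℕ → ℝ) (x : ℕ → ↥(Icc (-1 : ℝ) 1)) (n : ℕ) : ℝ :=
  (radialScale (δ n)⁻¹ (chainCarry δ x n, x (n + 1))).1

section Chain

variable {δ : ℕ → ℝ}

theorem abs_chainCarry_le (hδ : ∀ n, 0 < δ n) (x : ℕ → ↥(Icc (-1 : ℝ) 1)) (n : ℕ) :
    |chainCarry δ x n| ≤ 1 := by
  induction n with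
  | zero => exact abs_le.2 (x 0).2
  | succ n ih =>
    refine (norm_snd_le (radialScale (δ n)⁻¹ (chainCarry δ x n, x (n + 1)))).trans ?_
    rw [norm_radialScale (inv_pos.2 (hδ n)).ne']
    exact max_le ih (abs_le.2 (x (n + 1)).2)

theorem abs_chainOut_le (hδ : ∀ n, 0 < δ n) (x : ℕ → ↥(Icc (-1 : ℝ) 1)) (n : ℕ) :
    |chainOut δ x n| ≤ 1 := by
  refine (norm_fst_le (radialScale (δ n)⁻¹ (chainCarry δ x n, x (n + 1)))).trans ?_
  rw [norm_radialScale (inv_pos.2 (hδ n)).ne']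
  exact max_le (abs_chainCarry_le hδ x n) (abs_le.2 (x (n + 1)).2)

theorem continuous_chainCarry (hδ : ∀ n, 0 < δ n) (n : ℕ) :
    Continuous fun x => chainCarry δ x n := by
  induction n with
  | zero => exact continuous_subtype_val.comp (continuous_apply 0)
  | succ n ih =>
    exact ((continuous_radialScale (inv_pos.2 (hδ n)).ne').comp
      (ih.prodMk (continuous_subtype_val.comp (continuous_apply (n + 1))))).snd

theorem continuous_chainOut (hδ : ∀ n, 0 < δ n) (n : ℕ) :
    Continuous fun x => chainOut δ x n :=
  ((continuous_radialScale (inv_pos.2 (hδ n)).ne').comp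
    ((continuous_chainCarry hδ n).prodMk
      (continuous_subtype_val.comp (continuous_apply (n + 1))))).fst

theorem radialScale_chain (hδ : ∀ n, 0 < δ n) (x : ℕ → ↥(Icc (-1 : ℝ) 1)) (n : ℕ) :
    radialScale (δ n) (chainOut δ x n, chainCarry δ x (n + 1)) =
      (chainCarry δ x n, (x (n + 1) : ℝ)) := by
  have := radialScale_inv_radialScale (inv_pos.2 (hδ n)).ne' (chainCarry δ x n, (x (n + 1) : ℝ))
  rw [inv_inv] at this
  exact this

theorem chainCarry_congr {x x' : ℕ → ↥(Icc (-1 : ℝ) 1)} {n : ℕ} (h : ∀ i ≤ n, x i = x' i) :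
    chainCarry δ x n = chainCarry δ x' n := by
  induction n with
  | zero => simp [chainCarry, h 0 le_rfl]
  | succ n ih => simp only [chainCarry, ih fun i hi => h i (by omega), h (n + 1) le_rfl]

theorem chainOut_injective (hδ : ∀ n, 0 < δ n) (hδ1 : ∀ n, δ n ≤ 1)
    (hlim : Filter.Tendsto δ Filter.atTop (𝓝 1)) : Function.Injective (chainOut δ) := by
  intro x x' hxx
  have hstep : ∀ n, |chainCarry δ x n - chainCarry δ x' n| ≤
      |chainCarry δ x (n + 1) - chainCarry δ x' (n + 1)| := fun n => by
    have h1 := congrArg Prod.fst (radialScale_chain hδ x n)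
    have h2 := congrArg Prod.fst (radialScale_chain hδ x' n)
    rw [← hxx] at h2
    simp only at h1 h2
    rw [← h1, ← h2]
    exact abs_radialScale_fst_sub_le_abs (hδ n) (hδ1 n) _ _ _
  have hsmall : ∀ n, |chainCarry δ x n - chainCarry δ x' n| ≤ 1 - δ n := fun n => by
    have h1 := congrArg Prod.fst (radialScale_chain hδ x n)
    have h2 := congrArg Prod.fst (radialScale_chain hδ x' n)
    rw [← hxx] at h2
    simp only at h1 h2
    rw [← h1, ← h2]
    exact abs_radialScale_fst_sub_le_one_sub (hδ n) (hδ1 n)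
      (abs_chainCarry_le hδ x _) (abs_chainCarry_le hδ x' _)
  have hmono : Monotone fun n => |chainCarry δ x n - chainCarry δ x' n| :=
    monotone_nat_of_le_succ hstep
  have heq : ∀ n, chainCarry δ x n = chainCarry δ x' n := fun n => by
    have hl : Filter.Tendsto (fun m => 1 - δ m) Filter.atTop (𝓝 0) := by
      simpa using hlim.const_sub 1
    have := ge_of_tendsto hl (Filter.eventually_atTop.2
      ⟨n, fun m hm => (hmono hm).trans (hsmall m)⟩)
    exact sub_eq_zero.1 (abs_nonpos_iff.1 this)
  funext i
  cases i with
  | zero => exact Subtype.ext (heq 0)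
  | succ n =>
    have h1 := radialScale_chain hδ x n
    rw [hxx, heq (n + 1), radialScale_chain hδ x' n] at h1
    exact Subtype.ext (congrArg Prod.snd h1).symm

theorem exists_chainOut_eq_of_lt (hδ : ∀ n, 0 < δ n) (y : ℕ → ↥(Icc (-1 : ℝ) 1)) (n : ℕ) :
    ∀ w : ↥(Icc (-1 : ℝ) 1), ∃ x, (∀ i < n, chainOut δ x i = y i) ∧ chainCarry δ x n = w := by
  induction n with
  | zero => exact fun w => ⟨fun _ => w, by simp, rfl⟩
  | succ n ih =>
    intro w
    set z := radialScale (δ n) ((y n : ℝ), (w : ℝ)) with hz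
    have hz1 : ‖z‖ ≤ 1 := by
      rw [hz, norm_radialScale (hδ n).ne']
      exact max_le (abs_le.2 (y n).2) (abs_le.2 w.2)
    obtain ⟨x, hx, hxn⟩ := ih ⟨z.1, abs_le.1 ((norm_fst_le z).trans hz1)⟩
    have hval : radialScale (δ n)⁻¹ z = ((y n : ℝ), (w : ℝ)) :=
      radialScale_inv_radialScale (hδ n).ne' _
    set x' := Function.update x (n + 1) ⟨z.2, abs_le.1 ((norm_snd_le z).trans hz1)⟩ with hx'
    have hagree : ∀ i ≤ n, x' i = x i := fun i hi => by
      rw [hx', Function.update_of_ne (by omega)]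
    have hpair : (chainCarry δ x' n, (x' (n + 1) : ℝ)) = z := by
      rw [chainCarry_congr hagree, hxn, hx', Function.update_self]
    refine ⟨x', fun i hi => ?_, ?_⟩
    · rcases Nat.lt_succ_iff_lt_or_eq.1 hi with h | rfl
      · rw [← hx i h, chainOut, chainOut, chainCarry_congr fun j hj => hagree j (by omega),
          hagree (i + 1) (by omega)]
      · rw [chainOut, hpair, hval]
    · rw [chainCarry, hpair, hval]

theorem exists_chain_homeo (hδ : ∀ n, 0 < δ n) (hδ1 : ∀ n, δ n ≤ 1)
    (hlim : Filter.Tendsto δ Filter.atTop (𝓝 1)) :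
    ∃ h : (ℕ → ↥(Icc (-1 : ℝ) 1)) ≃ₜ (ℕ → ↥(Icc (-1 : ℝ) 1)),
      ∀ x n, (h x n : ℝ) = chainOut δ x n := by
  let f : (ℕ → ↥(Icc (-1 : ℝ) 1)) → (ℕ → ↥(Icc (-1 : ℝ) 1)) := fun x n =>
    ⟨chainOut δ x n, abs_le.1 (abs_chainOut_le hδ x n)⟩
  have hf : Continuous f := continuous_pi fun n => (continuous_chainOut hδ n).subtype_mk _
  have hinj : Function.Injective f := fun x x' h => chainOut_injective hδ hδ1 hlim <|
    funext fun n => congrArg Subtype.val (congrFun h n)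
  have hsurj : Function.Surjective f := fun y => by
    have hcl : ∀ n, IsClosed {x | ∀ i < n, f x i = y i} := fun n => by
      simp only [ofPred_forall]
      exact isClosed_iInter fun i => isClosed_iInter fun _ =>
        isClosed_eq ((continuous_apply i).comp hf) continuous_const
    obtain ⟨x, hx⟩ := IsCompact.nonempty_iInter_of_sequence_nonempty_isCompact_isClosed
      (fun n => {x | ∀ i < n, f x i = y i}) (fun n x hx i hi => hx i (by omega))
      (fun n => by
        obtain ⟨x, hx, -⟩ := exists_chainOut_eq_of_lt hδ y n (y 0)
        exact ⟨x, fun i hi => Subtype.ext (hx i hi)⟩)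
      (hcl 0).isCompact hcl
    exact ⟨x, funext fun i => mem_iInter.1 hx (i + 1) i i.lt_succ_self⟩
  exact ⟨hf.homeoOfEquivCompactToT2 (f := Equiv.ofBijective f ⟨hinj, hsurj⟩), fun _ _ => rfl⟩

end Chain

/-- A proper closed subset of `[0, 1]` can be pushed to within `1 - δ` of the ends of
`[-1, 1]`. -/
theorem exists_homeo_push_to_ends {N : Set ↥(Icc (0 : ℝ) 1)} (hN : IsClosed N) (hne : N ≠ Set.univ)
    {δ : ℝ} (hδ : 0 < δ) (hδ1 : δ < 1) :
    ∃ θ : ↥(Icc (0 : ℝ) 1) ≃ₜ ↥(Icc (-1 : ℝ) 1), ∀ t ∈ N, δ < |(θ t : ℝ)| := by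
  obtain ⟨a, b, ha, hab, hb, hgap⟩ : ∃ a b : ℝ, 0 ≤ a ∧ a < b ∧ b ≤ 1 ∧
      ∀ t ∈ N, (t : ℝ) ≤ a ∨ b ≤ t := by
    obtain ⟨p, hp⟩ := (ne_univ_iff_exists_notMem N).1 hne
    obtain ⟨ε, hε, hball⟩ := Metric.isOpen_iff.1 hN.isOpen_compl p hp
    have hε' : ∀ t ∈ N, ε ≤ |(t : ℝ) - p| := fun t ht => by
      by_contra! h
      exact hball (Metric.mem_ball.2 h) ht
    have hp0 := p.2.1
    have hp1 := p.2.2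
    rcases lt_or_ge (p : ℝ) 1 with h1 | h1
    · refine ⟨p, min (p + ε) 1, hp0, lt_min (by linarith) h1, min_le_right _ _, fun t ht => ?_⟩
      rcases le_total (t : ℝ) p with h | h
      · exact Or.inl h
      · right
        have := hε' t ht
        rw [abs_of_nonneg (by linarith)] at this
        exact (min_le_left _ _).trans (by linarith)
    · refine ⟨max (p - ε) 0, p, le_max_right _ _, max_lt (by linarith) (by linarith), hp1,
        fun t ht => ?_⟩
      left
      have h2 := hε' t ht
      rw [abs_of_nonpos (by linarith [t.2.2])] at h2
      exact le_max_of_le_left (by linarith)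
  set ε := (1 - δ) / 2 with hε
  have hε0 : 0 < ε := by rw [hε]; linarith
  have hε2 : 0 ≤ 2 - ε := by rw [hε]; linarith
  have hba : 0 < b - a := sub_pos.2 hab
  let f : ℝ → ℝ := fun t => -1 + ε * t + (2 - ε) * ((max a (min t b) - a) / (b - a))
  have hf : Continuous f := by fun_prop
  have hmono : StrictMono f := fun s t hst => by
    have h1 : max a (min s b) ≤ max a (min t b) :=
      max_le_max le_rfl (min_le_min hst.le le_rfl)
    have h2 : (max a (min s b) - a) / (b - a) ≤ (max a (min t b) - a) / (b - a) := by gcongr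
    have h3 := mul_le_mul_of_nonneg_left h2 hε2
    have h4 := mul_lt_mul_of_pos_left hst hε0
    simp only [f]
    linarith
  have hlow : ∀ t ≤ a, f t = -1 + ε * t := fun t ht => by
    simp [f, min_eq_left (ht.trans hab.le), max_eq_left ht]
  have hhigh : ∀ t, b ≤ t → f t = 1 - ε * (1 - t) := fun t ht => by
    simp only [f, min_eq_right ht, max_eq_right hab.le, div_self hba.ne']
    ring
  have hf0 : f 0 = -1 := by rw [hlow 0 ha]; ring
  have hf1 : f 1 = 1 := by rw [hhigh 1 hb]; ring
  let F : ↥(Icc (0 : ℝ) 1) → ↥(Icc (-1 : ℝ) 1) := fun t =>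
    ⟨f t, hf0.ge.trans (hmono.monotone t.2.1), (hmono.monotone t.2.2).trans hf1.le⟩
  have hFc : Continuous F := (hf.comp continuous_subtype_val).subtype_mk _
  have hFb : Function.Bijective F := by
    refine ⟨fun s t h => Subtype.ext (hmono.injective (congrArg Subtype.val h)), fun y => ?_⟩
    have := intermediate_value_Icc (zero_le_one' ℝ) hf.continuousOn
    rw [hf0, hf1] at this
    obtain ⟨t, ht, hty⟩ := this y.2
    exact ⟨⟨t, ht⟩, Subtype.ext hty⟩
  refine ⟨hFc.homeoOfEquivCompactToT2 (f := Equiv.ofBijective F hFb), fun t ht => ?_⟩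
  change δ < |f t|
  have ht0 := t.2.1
  have ht1 := t.2.2
  rcases hgap t ht with h | h
  · rw [hlow _ h, lt_abs]
    right
    nlinarith
  · rw [hhigh _ h, lt_abs]
    left
    nlinarith

/-- A product of proper closed subsets of `[0, 1]` can be moved into the pseudo-interior. -/
theorem exists_homeo_push_to_pseudoInterior {N : ℕ → Set ↥(Icc (0 : ℝ) 1)}
    (hN : ∀ i, IsClosed (N i)) (hne : ∀ i, N i ≠ Set.univ) :
    ∃ h : HilbertCube ≃ₜ HilbertCube, ∀ x, (∀ i, x i ∈ N i) → h x ∈ pseudoInterior := by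
  let δ : ℕ → ℝ := fun n => 1 - 1 / ((n : ℝ) + 2)
  have hpos : ∀ n : ℕ, 0 < 1 / ((n : ℝ) + 2) := fun n => by positivity
  have hδ : ∀ n, 0 < δ n := fun n => by
    have : 1 / ((n : ℝ) + 2) < 1 :=
      (div_lt_one (by positivity)).2 (by linarith [n.cast_nonneg (α := ℝ)])
    simp only [δ]; linarith
  have hδ1 : ∀ n, δ n < 1 := fun n => by simp only [δ]; linarith [hpos n]
  have hlim : Filter.Tendsto δ Filter.atTop (𝓝 1) := by
    have h := (Filter.tendsto_add_atTop_iff_nat 1).2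
      (tendsto_one_div_add_atTop_nhds_zero_nat (𝕜 := ℝ))
    have h2 : Filter.Tendsto (fun n : ℕ => 1 / ((n : ℝ) + 2)) Filter.atTop (𝓝 0) := by
      refine h.congr fun n => ?_
      push_cast
      ring
    simpa [δ] using h2.const_sub 1
  obtain ⟨H, hH⟩ := exists_chain_homeo hδ (fun n => (hδ1 n).le) hlim
  choose θ hθ using fun i => exists_homeo_push_to_ends (hN i) (hne i) (hδ (i - 1)) (hδ1 (i - 1))
  let σ : ↥(Icc (-1 : ℝ) 1) ≃ₜ ↥(Icc (0 : ℝ) 1) :=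
    { toFun := fun t => ⟨(t + 1) / 2, by linarith [t.2.1], by linarith [t.2.2]⟩
      invFun := fun t => ⟨2 * t - 1, by linarith [t.2.1], by linarith [t.2.2]⟩
      left_inv := fun t => Subtype.ext (by simp; ring)
      right_inv := fun t => Subtype.ext (by simp)
      continuous_toFun := by fun_prop
      continuous_invFun := by fun_prop }
  refine ⟨((Homeomorph.piCongrRight θ).trans H).trans (Homeomorph.piCongrRight fun _ => σ),
    fun x hx n => ?_⟩
  have h1 : |(H (Homeomorph.piCongrRight θ x) n : ℝ)| < 1 := by
    rw [hH]
    refine abs_radialScale_fst_lt_one (hδ n) (abs_chainCarry_le hδ _ n)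
      (abs_le.2 (Homeomorph.piCongrRight θ x (n + 1)).2) ?_
    exact hθ (n + 1) _ (hx (n + 1))
  have h2 := abs_lt.1 h1
  change ((H (Homeomorph.piCongrRight θ x) n : ℝ) + 1) / 2 ∈ Ioo (0 : ℝ) 1
  exact ⟨by linarith, by linarith⟩

theorem IsUnknotted.comp {K L : Type*} [TopologicalSpace K] [TopologicalSpace L]
    {α : K → HilbertCube × HilbertCube} (hα : IsUnknotted α) {e : L → K} (he : Continuous e)
    (hei : Function.Injective e) : IsUnknotted (α ∘ e) :=
  ⟨hα.continuous.comp he, fun _ => hα.fst_mem _, fun _ => hα.snd_mem _,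
    hα.injective_fst.comp hei⟩

/-- Splitting the coordinates of the Hilbert cube into the even and the odd ones. -/
def splitHomeo : HilbertCube ≃ₜ HilbertCube × HilbertCube where
  toFun x := (fun i => x (Equiv.natSumNatEquivNat (Sum.inl i)),
    fun i => x (Equiv.natSumNatEquivNat (Sum.inr i)))
  invFun p n := Sum.elim p.1 p.2 (Equiv.natSumNatEquivNat.symm n)
  left_inv x := funext fun n => by
    obtain ⟨m | m, rfl⟩ := Equiv.natSumNatEquivNat.surjective n <;>
      simp only [Equiv.symm_apply_apply, Sum.elim_inl, Sum.elim_inr]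
  right_inv p := by simp only [Equiv.symm_apply_apply, Sum.elim_inl, Sum.elim_inr]
  continuous_toFun := by fun_prop
  continuous_invFun := continuous_pi fun n => by
    rcases Equiv.natSumNatEquivNat.symm n with m | m
    · exact (continuous_apply m).comp continuous_fst
    · exact (continuous_apply m).comp continuous_snd

/-- The standard embedding of the Cantor cube into `I^ω × I^ω`. -/
noncomputable def cantorMap (t : ℕ → Bool) : HilbertCube × HilbertCube :=
  (fun i => ⟨if t i then 3 / 4 else 1 / 4, by split_ifs <;> norm_num⟩,
    fun _ => ⟨1 / 2, by norm_num⟩)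

theorem isUnknotted_cantorMap : IsUnknotted cantorMap where
  continuous := (continuous_pi fun i => ((continuous_of_discreteTopology
    (f := fun z : Bool => if z then (3 / 4 : ℝ) else 1 / 4)).comp
      (continuous_apply i)).subtype_mk _).prodMk continuous_const
  fst_mem t i := by
    change (if t i then (3 / 4 : ℝ) else 1 / 4) ∈ Ioo (0 : ℝ) 1
    split_ifs <;> norm_num
  snd_mem _ _ := by
    change (1 / 2 : ℝ) ∈ Ioo (0 : ℝ) 1
    norm_num
  injective_fst s t h := funext fun i => by
    have := congrArg Subtype.val (congrFun h i)
    simp only [cantorMap] at this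
    cases hs : s i <;> cases ht : t i <;> norm_num [hs, ht] at this <;> rfl

/-- The standard Cantor set in the Hilbert cube. -/
def standardCantorSet : Set HilbertCube := range fun t => splitHomeo.symm (cantorMap t)

/-- A product of closed subsets of `[0, 1]` with empty interiors embeds in the Cantor cube. -/
theorem exists_bits_of_interior_eq_empty {N : ℕ → Set ↥(Icc (0 : ℝ) 1)}
    (hN : ∀ i, interior (N i) = ∅) :
    ∃ b : Set.pi Set.univ N → ℕ → Bool, Continuous b ∧ Function.Injective b := by
  have hq : ∀ i, ∃ q : ℕ → ↥(Icc (0 : ℝ) 1), (∀ n, q n ∉ N i) ∧ DenseRange q := fun i => by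
    obtain ⟨T, hT, hTc, hTd⟩ := Dense.exists_countable_dense_subset
      (interior_eq_empty_iff_dense_compl.1 (hN i))
    obtain ⟨q, rfl⟩ := hTc.exists_eq_range hTd.nonempty
    exact ⟨q, fun n => hT ⟨n, rfl⟩, hTd⟩
  choose q hqN hqd using hq
  refine ⟨fun x m => decide (q m.unpair.1 m.unpair.2 < x.1 m.unpair.1), ?_, ?_⟩
  · refine continuous_pi fun m => (continuous_bool_rng true).2 ?_
    have hcont : Continuous fun x : Set.pi Set.univ N => x.1 m.unpair.1 :=
      (continuous_apply _).comp continuous_subtype_val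
    constructor
    · convert isClosed_le (continuous_const (y := q m.unpair.1 m.unpair.2)) hcont using 1
      ext x
      have hne : q m.unpair.1 m.unpair.2 ≠ x.1 m.unpair.1 := fun h =>
        hqN m.unpair.1 m.unpair.2 (h ▸ x.2 _ (mem_univ _))
      simp [hne.le_iff_lt]
    · convert isOpen_lt (continuous_const (y := q m.unpair.1 m.unpair.2)) hcont using 1
      ext x
      simp
  · intro x y hxy
    have key : ∀ i n, q i n < x.1 i ↔ q i n < y.1 i := fun i n => by
      simpa using congrFun hxy (Nat.pair i n)
    refine Subtype.ext (funext fun i => ?_)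
    by_contra hne
    rcases lt_or_gt_of_ne hne with h | h
    · obtain ⟨n, hn⟩ := (hqd i).exists_mem_open isOpen_Ioo (nonempty_Ioo.2 h)
      exact absurd ((key i n).2 hn.2) hn.1.not_gt
    · obtain ⟨n, hn⟩ := (hqd i).exists_mem_open isOpen_Ioo (nonempty_Ioo.2 h)
      exact absurd ((key i n).1 hn.2) hn.1.not_gt

/-- A product of closed subsets of `[0, 1]` with empty interiors can be moved into the standard
Cantor set. -/
theorem exists_homeo_mem_standardCantorSet {N : ℕ → Set ↥(Icc (0 : ℝ) 1)}
    (hN : ∀ i, IsClosed (N i)) (hNi : ∀ i, interior (N i) = ∅) :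
    ∃ H : HilbertCube ≃ₜ HilbertCube, ∀ x, (∀ i, x i ∈ N i) → H x ∈ standardCantorSet := by
  have hne : ∀ i, N i ≠ Set.univ := fun i h => by
    have := hNi i
    rw [h, interior_univ] at this
    exact Set.univ_nonempty.ne_empty this
  have half : ∀ s : ℕ → ℕ, CompactSpace (Set.pi Set.univ fun i => N (s i)) ∧
      (∃ b : Set.pi Set.univ (fun i => N (s i)) → ℕ → Bool,
        Continuous b ∧ Function.Injective b) ∧
      ∃ h : HilbertCube ≃ₜ HilbertCube,
        ∀ x ∈ Set.pi Set.univ (fun i => N (s i)), h x ∈ pseudoInterior :=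
    fun s => ⟨isCompact_iff_compactSpace.1 (isClosed_set_pi fun i _ => hN (s i)).isCompact,
      exists_bits_of_interior_eq_empty fun i => hNi (s i),
      by simpa using exists_homeo_push_to_pseudoInterior (fun i => hN (s i)) fun i => hne (s i)⟩
  obtain ⟨hK, ⟨b, hb, hbi⟩, h₁, hh₁⟩ := half fun i => Equiv.natSumNatEquivNat (Sum.inl i)
  obtain ⟨hL, ⟨c, hc, hci⟩, h₂, hh₂⟩ := half fun i => Equiv.natSumNatEquivNat (Sum.inr i)
  obtain ⟨h, hh⟩ := exists_homeo_isUnknotted_of_bits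
    (h₁.continuous.comp continuous_subtype_val) (h₁.injective.comp Subtype.val_injective)
    (fun k => hh₁ _ k.2)
    (h₂.continuous.comp continuous_subtype_val) (h₂.injective.comp Subtype.val_injective)
    (fun k => hh₂ _ k.2) hc hci
  have hε : Continuous fun p : Set.pi Set.univ (fun i => N (Equiv.natSumNatEquivNat (Sum.inl i))) ×
      Set.pi Set.univ (fun i => N (Equiv.natSumNatEquivNat (Sum.inr i))) =>
      fun n => Sum.elim (b p.1) (c p.2) (Equiv.natSumNatEquivNat.symm n) :=
    continuous_pi fun n => by
      rcases Equiv.natSumNatEquivNat.symm n with m | m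
      · exact (continuous_apply m).comp (hb.comp continuous_fst)
      · exact (continuous_apply m).comp (hc.comp continuous_snd)
  obtain ⟨h', hh'⟩ := hh.exists_homeo (isUnknotted_cantorMap.comp hε fun p p' hp => by
    refine Prod.ext (hbi <| funext fun m => ?_) (hci <| funext fun m => ?_)
    · simpa only [Equiv.symm_apply_apply, Sum.elim_inl] using
        congrFun hp (Equiv.natSumNatEquivNat (Sum.inl m))
    · simpa only [Equiv.symm_apply_apply, Sum.elim_inr] using
        congrFun hp (Equiv.natSumNatEquivNat (Sum.inr m)))
  refine ⟨(((splitHomeo.trans (h₁.prodCongr h₂)).trans h).trans h').trans splitHomeo.symm,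
    fun x hx => ⟨_, congrArg splitHomeo.symm (hh' (⟨(splitHomeo x).1, fun i _ => hx _⟩,
      ⟨(splitHomeo x).2, fun i _ => hx _⟩)).symm⟩⟩

/-- A map of the Cantor cube which is injective in the first factor and misses a value in every
coordinate is ambiently homeomorphic to the standard embedding. -/
theorem exists_homeo_cantorMap_eq {γ : (ℕ → Bool) → HilbertCube × HilbertCube}
    (hγ : Continuous γ) (hinj : Function.Injective fun t => (γ t).1)
    (h₁ : ∀ i, range (fun t => (γ t).1 i) ≠ Set.univ)
    (h₂ : ∀ i, range (fun t => (γ t).2 i) ≠ Set.univ) :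
    ∃ h : HilbertCube × HilbertCube ≃ₜ HilbertCube × HilbertCube, ∀ t, h (cantorMap t) = γ t := by
  obtain ⟨k₁, hk₁⟩ := exists_homeo_push_to_pseudoInterior
    (fun i => (isCompact_range (f := fun t => (γ t).1 i) (by fun_prop)).isClosed) h₁
  obtain ⟨k₂, hk₂⟩ := exists_homeo_push_to_pseudoInterior
    (fun i => (isCompact_range (f := fun t => (γ t).2 i) (by fun_prop)).isClosed) h₂
  have hunk : IsUnknotted fun t => (k₁.prodCongr k₂) (γ t) :=
    ⟨(Homeomorph.continuous _).comp hγ, fun t => hk₁ _ fun i => ⟨t, rfl⟩,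
      fun t => hk₂ _ fun i => ⟨t, rfl⟩, k₁.injective.comp hinj⟩
  obtain ⟨h, hh⟩ := isUnknotted_cantorMap.exists_homeo hunk
  exact ⟨h.trans (k₁.prodCongr k₂).symm, fun t => by
    rw [Homeomorph.trans_apply, hh, Homeomorph.symm_apply_apply]⟩

/-- An open set on which `G` is not constant contains small open sets with separated
`G`-images. -/
theorem exists_isOpen_pair {X Z : Type*} [TopologicalSpace X] [RegularSpace X]
    [TopologicalSpace Z] [T2Space Z] {G : X → Z} (hG : Continuous G) {V : Set X} (hV : IsOpen V)
    (hne : ∃ x ∈ V, ∃ y ∈ V, G x ≠ G y) {E : Set (X × X)} (hE : ∀ x, E ∈ 𝓝 (x, x)) :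
    ∃ W : Bool → Set X, (∀ b, IsOpen (W b) ∧ (W b).Nonempty ∧ closure (W b) ⊆ V ∧
      W b ×ˢ W b ⊆ E) ∧ Disjoint (G '' W false) (G '' W true) := by
  have small : ∀ x ∈ V, ∀ P, IsOpen P → G x ∈ P → ∃ W, IsOpen W ∧ W.Nonempty ∧ closure W ⊆ V ∧
      W ×ˢ W ⊆ E ∧ G '' W ⊆ P := fun x hx P hP hxP => by
    obtain ⟨T, hT, hTE⟩ := Filter.mem_prod_same_iff.1 ((nhds_prod_eq (x := x) (y := x)).ge (hE x))
    obtain ⟨S, hS, hSc, hSs⟩ := exists_mem_nhds_isClosed_subset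
      (Filter.inter_mem (Filter.inter_mem hT (hV.mem_nhds hx)) (hG.continuousAt (hP.mem_nhds hxP)))
    refine ⟨interior S, isOpen_interior, ⟨x, mem_interior_iff_mem_nhds.2 hS⟩, ?_, ?_, ?_⟩
    · exact (closure_minimal interior_subset hSc).trans fun y hy => (hSs hy).1.2
    · exact (prod_mono (fun y hy => (hSs (interior_subset hy)).1.1)
        fun y hy => (hSs (interior_subset hy)).1.1).trans hTE
    · rintro _ ⟨y, hy, rfl⟩
      exact (hSs (interior_subset hy)).2
  obtain ⟨x, hx, y, hy, hxy⟩ := hne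
  obtain ⟨P, P', hP, hP', hxP, hyP, hPP⟩ := t2_separation hxy
  obtain ⟨W, h1, h2, h3, h4, h5⟩ := small x hx P hP hxP
  obtain ⟨W', h1', h2', h3', h4', h5'⟩ := small y hy P' hP' hyP
  refine ⟨fun b => if b then W' else W, fun b => ?_, hPP.mono (by simpa using h5)
    (by simpa using h5')⟩
  cases b
  · exact ⟨h1, h2, h3, h4⟩
  · exact ⟨h1', h2', h3', h4'⟩

/-- A scheme of points indexed by the Cantor cube, with prescribed smallness and with injective
`G`-image, inside a compact space on no open part of which `G` is constant. -/
theorem exists_small_injective_scheme {X Z : Type*} [TopologicalSpace X] [CompactSpace X]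
    [T2Space X] [TopologicalSpace Z] [T2Space Z] {G : X → Z} (hG : Continuous G) {O : Set X}
    (hO : IsOpen O) (hOne : O.Nonempty)
    (hGO : ∀ V ⊆ O, IsOpen V → V.Nonempty → ∃ x ∈ V, ∃ y ∈ V, G x ≠ G y)
    {E : ℕ → Set (X × X)} (hE : ∀ n x, E n ∈ 𝓝 (x, x)) :
    ∃ e : (ℕ → Bool) → X, Function.Injective (G ∘ e) ∧
      ∀ n t, ∀ t' ∈ PiNat.cylinder t (n + 1), (e t, e t') ∈ E n := by
  choose W hW hWd using fun (V : {V : Set X // IsOpen V ∧ V.Nonempty ∧ V ⊆ O}) (n : ℕ) =>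
    exists_isOpen_pair hG V.2.1 (hGO V V.2.2.2 V.2.1 V.2.2.1) (hE n)
  let A : List Bool → {V : Set X // IsOpen V ∧ V.Nonempty ∧ V ⊆ O} := fun l =>
    l.rec ⟨O, hO, hOne, subset_rfl⟩ fun b s V => ⟨W V s.length b, (hW V s.length b).1,
      (hW V s.length b).2.1, (subset_closure.trans (hW V s.length b).2.2.1).trans V.2.2.2⟩
  have hA : ∀ b s, (A (b :: s)).1 = W (A s) s.length b := fun _ _ => rfl
  have hcl : ∀ b s, closure (A (b :: s)).1 ⊆ (A s).1 := fun b s => (hW (A s) s.length b).2.2.1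
  have hex : ∀ t : ℕ → Bool, ∃ x, ∀ n, x ∈ (A (PiNat.res t n)).1 := fun t => by
    obtain ⟨x, hx⟩ := IsCompact.nonempty_iInter_of_sequence_nonempty_isCompact_isClosed
      (fun n => closure (A (PiNat.res t n)).1)
      (fun n => (hcl _ _).trans subset_closure)
      (fun n => (A (PiNat.res t n)).2.2.1.closure) isClosed_closure.isCompact
      fun _ => isClosed_closure
    exact ⟨x, fun n => hcl _ _ (mem_iInter.1 hx (n + 1))⟩
  choose e he using hex
  refine ⟨e, fun t t' htt => ?_, fun n t t' ht' => ?_⟩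
  · by_contra hne
    set n := PiNat.firstDiff t t'
    have hres : PiNat.res t n = PiNat.res t' n :=
      PiNat.res_eq_res.2 fun m hm => PiNat.apply_eq_of_lt_firstDiff hm
    have hd : t n ≠ t' n := PiNat.apply_firstDiff_ne hne
    have h1 := he t (n + 1)
    have h2 := he t' (n + 1)
    rw [PiNat.res_succ, hA] at h1 h2
    rw [← hres] at h2
    have := Set.disjoint_left.1 (hWd (A (PiNat.res t n)) (PiNat.res t n).length)
    cases ht : t n <;> cases ht' : t' n <;> simp only [ht, ht'] at h1 h2 hd
    · exact hd rfl
    · exact this ⟨_, h1, rfl⟩ ⟨_, h2, htt.symm⟩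
    · exact this ⟨_, h2, rfl⟩ ⟨_, h1, htt⟩
    · exact hd rfl
  · have h1 := he t (n + 1)
    have h2 := he t' (n + 1)
    have hres : PiNat.res t' (n + 1) = PiNat.res t (n + 1) :=
      PiNat.res_eq_res.2 fun m hm => ht' m hm
    rw [hres] at h2
    rw [PiNat.res_succ, hA] at h1 h2
    have := (hW (A (PiNat.res t n)) (PiNat.res t n).length (t n)).2.2.2 (mk_mem_prod h1 h2)
    rwa [PiNat.res_length] at this

/-- A map of the Cantor cube to the interval contracting cylinders fast enough is not onto. -/
theorem range_ne_univ_of_dist_lt {f : (ℕ → Bool) → ↥(Icc (0 : ℝ) 1)} {n : ℕ}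
    (hf : ∀ t, ∀ t' ∈ PiNat.cylinder t n, dist (f t) (f t') < 1 / 2 ^ n) :
    range f ≠ Set.univ := by
  intro hr
  have hsurj : ∀ y, ∃ t, f t = y := range_eq_univ.1 hr
  choose g hg using hsurj
  let p : Fin (2 ^ n + 1) → ↥(Icc (0 : ℝ) 1) := fun k => ⟨k / 2 ^ n, by positivity,
    (div_le_one (by positivity)).2 (by exact_mod_cast Nat.lt_succ_iff.1 k.2)⟩
  obtain ⟨k, l, hkl, heq⟩ := Fintype.exists_ne_map_eq_of_card_lt
    (fun k (i : Fin n) => g (p k) i) (by simp)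
  have h1 := hf (g (p l)) (g (p k)) fun i hi => congrFun heq ⟨i, hi⟩
  rw [hg, hg, Subtype.dist_eq, Real.dist_eq] at h1
  simp only [p, ← sub_div, abs_div] at h1
  rw [abs_of_pos (by positivity : (0 : ℝ) < 2 ^ n), div_lt_div_iff_of_pos_right (by positivity)]
    at h1
  have h2 : |((l : ℕ) : ℤ) - ((k : ℕ) : ℤ)| < 1 := by exact_mod_cast h1
  rw [Int.abs_lt_one_iff] at h2
  exact hkl (Fin.ext (by omega))

/-- In a compact space mapped to the Hilbert cube, if `G` is constant on no open subset of `O`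
then there is a copy of the Cantor cube on which `G` is injective and which misses a value in
every coordinate. -/
theorem exists_injective_range_ne_univ {X Z : Type*} [TopologicalSpace X] [CompactSpace X]
    [T2Space X] [TopologicalSpace Z] [T2Space Z] {G : X → Z} (hG : Continuous G) {O : Set X}
    (hO : IsOpen O) (hOne : O.Nonempty)
    (hGO : ∀ V ⊆ O, IsOpen V → V.Nonempty → ∃ x ∈ V, ∃ y ∈ V, G x ≠ G y)
    {ι : X → HilbertCube} (hι : Continuous ι) :
    ∃ e : (ℕ → Bool) → X, Function.Injective (G ∘ e) ∧ Continuous (ι ∘ e) ∧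
      ∀ i, range (fun t => ι (e t) i) ≠ Set.univ := by
  obtain ⟨e, he, hsmall⟩ := exists_small_injective_scheme hG hO hOne hGO
    (E := fun n => {p | ∀ i ∈ Iic n, dist (ι p.1 i) (ι p.2 i) < 1 / 2 ^ (n + 1)}) fun n x => by
      refine IsOpen.mem_nhds ?_ fun i _ => by simp
      simp only [ofPred_forall]
      refine (finite_Iic n).isOpen_biInter fun i _ => isOpen_lt ?_ continuous_const
      exact ((continuous_apply i).comp (hι.comp continuous_fst)).dist
        ((continuous_apply i).comp (hι.comp continuous_snd))
  refine ⟨e, he, continuous_pi fun i => continuous_iff_continuousAt.2 fun t => ?_, fun i =>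
    range_ne_univ_of_dist_lt (n := i + 1) fun t t' ht => hsmall i t t' ht i self_mem_Iic⟩
  refine Metric.tendsto_nhds.2 fun ε hε => ?_
  obtain ⟨n, hn⟩ := exists_pow_lt_of_lt_one hε (show (1 / 2 : ℝ) < 1 by norm_num)
  filter_upwards [(PiNat.isOpen_cylinder _ t (max i n + 1)).mem_nhds (PiNat.self_mem_cylinder _ _)]
    with t' ht'
  rw [dist_comm]
  refine (hsmall _ t t' ht' i (le_max_left i n)).trans (lt_of_le_of_lt ?_ hn)
  rw [one_div_pow]
  exact one_div_le_one_div_of_le (by positivity)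
    (pow_le_pow_right₀ one_le_two (by have := le_max_right i n; omega))

theorem exists_ne_mem_of_isOpen {V : Set (ℕ → Bool)} (hV : IsOpen V) (hne : V.Nonempty) :
    ∃ x ∈ V, ∃ y ∈ V, x ≠ y := by
  obtain ⟨x, hx⟩ := hne
  have hlim : Filter.Tendsto (fun n => Function.update x n (!x n)) Filter.atTop (𝓝 x) := by
    refine tendsto_pi_nhds.2 fun i => tendsto_const_nhds.congr' ?_
    filter_upwards [Filter.eventually_gt_atTop i] with n hn
    rw [Function.update_of_ne hn.ne]
  obtain ⟨n, hn⟩ := (hlim.eventually (hV.mem_nhds hx)).exists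
  refine ⟨x, hx, _, hn, fun h => ?_⟩
  have := congrFun h n
  simp at this

theorem isMinimalCantorSet_standardCantorSet : IsMinimalCantorSet standardCantorSet := by
  constructor
  · have hc : Continuous fun t => splitHomeo.symm (cantorMap t) :=
      splitHomeo.symm.continuous.comp isUnknotted_cantorMap.continuous
    have hi : Function.Injective fun t => splitHomeo.symm (cantorMap t) :=
      splitHomeo.symm.injective.comp fun s t h =>
        isUnknotted_cantorMap.injective_fst (congrArg Prod.fst h)
    exact ⟨(hc.isClosedEmbedding hi).isEmbedding.toHomeomorph.symm⟩
  · rintro B ⟨φ⟩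
    set ι : (ℕ → Bool) → HilbertCube := fun t => φ.symm t with hιdef
    have hι : Continuous ι := continuous_subtype_val.comp φ.symm.continuous
    have hιi : Function.Injective ι := Subtype.val_injective.comp φ.symm.injective
    have hs : Continuous fun t => splitHomeo (ι t) := splitHomeo.continuous.comp hι
    suffices ∃ (s : HilbertCube × HilbertCube ≃ₜ HilbertCube × HilbertCube)
        (e : (ℕ → Bool) → ℕ → Bool), ∀ t, s (cantorMap t) = splitHomeo (ι (e t)) by
      obtain ⟨s, e, hse⟩ := this
      refine ⟨(splitHomeo.trans s).trans splitHomeo.symm, ?_⟩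
      rintro _ ⟨_, ⟨t, rfl⟩, rfl⟩
      have : ((splitHomeo.trans s).trans splitHomeo.symm) (splitHomeo.symm (cantorMap t)) =
          ι (e t) := by
        simp only [Homeomorph.trans_apply, Homeomorph.apply_symm_apply, hse,
          Homeomorph.symm_apply_apply]
      rw [this]
      exact (φ.symm (e t)).2
    by_cases hconst : ∀ V : Set (ℕ → Bool), IsOpen V → V.Nonempty →
        ∃ x ∈ V, ∃ y ∈ V, (splitHomeo (ι x)).1 ≠ (splitHomeo (ι y)).1
    · obtain ⟨e, he, hec, hr⟩ := exists_injective_range_ne_univ hs.fst isOpen_univ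
        Set.univ_nonempty (fun V _ => hconst V) hι
      obtain ⟨h, hh⟩ := exists_homeo_cantorMap_eq (splitHomeo.continuous.comp hec) he
        (fun i => hr _) fun i => hr _
      exact ⟨h, e, hh⟩
    · push Not at hconst
      obtain ⟨O, hO, hOne, hOc⟩ := hconst
      obtain ⟨e, he, hec, hr⟩ := exists_injective_range_ne_univ hs.snd hO hOne
        (fun V hVO hV hVne => by
          obtain ⟨x, hx, y, hy, hxy⟩ := exists_ne_mem_of_isOpen hV hVne
          exact ⟨x, hx, y, hy, fun h => hxy (hιi (splitHomeo.injective
            (Prod.ext (hOc x (hVO hx) y (hVO hy)) h)))⟩) hι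
      obtain ⟨h, hh⟩ := exists_homeo_cantorMap_eq
        (γ := fun t => (splitHomeo (ι (e t))).swap)
        (continuous_swap.comp (splitHomeo.continuous.comp hec)) he (fun i => hr _) fun i => hr _
      exact ⟨h.trans (Homeomorph.prodComm _ _), e, fun t => by
        rw [Homeomorph.trans_apply, hh]
        rfl⟩

theorem IsMinimalCantorSet.preimage {A : Set HilbertCube} (hA : IsMinimalCantorSet A)
    (H : HilbertCube ≃ₜ HilbertCube) : IsMinimalCantorSet (H ⁻¹' A) := by
  obtain ⟨⟨φ⟩, hmin⟩ := hA
  refine ⟨⟨(H.sets rfl).trans φ⟩, fun B hB => ?_⟩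
  obtain ⟨h, hh⟩ := hmin B hB
  refine ⟨H.trans h, ?_⟩
  rintro _ ⟨x, hx, rfl⟩
  exact hh ⟨H x, hx, rfl⟩

/-- A continuous injective semi-open image of a closed nowhere dense set is nowhere dense. -/
theorem interior_closure_image_eq_empty {X Y : Type*} [TopologicalSpace X] [TopologicalSpace Y]
    {φ : X → Y} (hc : Continuous φ) (hb : Function.Bijective φ)
    (hso : ∀ U, IsOpen U → U.Nonempty → (interior (φ '' U)).Nonempty) {S : Set X}
    (hS : IsClosed S) (hSi : interior S = ∅) : interior (closure (φ '' S)) = ∅ := by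
  by_contra hne
  obtain ⟨y, hy⟩ := Set.nonempty_iff_ne_empty.2 hne
  obtain ⟨x, rfl⟩ := hb.2 y
  have hopen : IsOpen (φ ⁻¹' interior (closure (φ '' S)) ∩ Sᶜ) :=
    (isOpen_interior.preimage hc).inter hS.isOpen_compl
  obtain ⟨z, hz⟩ := (interior_eq_empty_iff_dense_compl.1 hSi).inter_open_nonempty _
    (isOpen_interior.preimage hc) ⟨x, hy⟩
  obtain ⟨w, hw⟩ := hso _ hopen ⟨z, hz⟩
  have hwc : w ∈ closure (φ '' S) := by
    obtain ⟨v, hv, rfl⟩ := interior_subset hw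
    exact interior_subset hv.1
  obtain ⟨_, h1, v, hv, rfl⟩ := mem_closure_iff.1 hwc _ isOpen_interior hw
  obtain ⟨u, hu, huv⟩ := interior_subset h1
  exact hu.2 (hb.1 huv ▸ hv)

theorem isClosed_ne_int_seq (g : ℕ → ℤ) : IsClosed {x : ℕ → ℤ | ∀ n, x n ≠ g n} := by
  simp only [ofPred_forall]
  exact isClosed_iInter fun n =>
    (isClosed_discrete {m : ℤ | m ≠ g n}).preimage (continuous_apply (A := fun _ => ℤ) n)

theorem interior_ne_int_seq_eq_empty (g : ℕ → ℤ) :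
    interior {x : ℕ → ℤ | ∀ n, x n ≠ g n} = ∅ := by
  refine eq_empty_of_forall_notMem fun x hx => ?_
  have hlim : Filter.Tendsto (fun n => Function.update x n (g n)) Filter.atTop (𝓝 x) := by
    refine tendsto_pi_nhds.2 fun i => tendsto_const_nhds.congr' ?_
    filter_upwards [Filter.eventually_gt_atTop i] with n hn
    rw [Function.update_of_ne hn.ne]
  obtain ⟨n, hn⟩ := (hlim.eventually (isOpen_interior.mem_nhds hx)).exists
  exact interior_subset hn n (Function.update_self ..)

/-- A countable power of a surjective semi-open map is semi-open. -/
theorem nonempty_interior_image_pi {X Y : Type*} [TopologicalSpace X] [TopologicalSpace Y]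
    {φ : X → Y} (hs : Function.Surjective φ)
    (hso : ∀ U, IsOpen U → U.Nonempty → (interior (φ '' U)).Nonempty)
    {U : Set (ℕ → X)} (hU : IsOpen U) (hne : U.Nonempty) :
    (interior ((fun (x : ℕ → X) i => φ (x i)) '' U)).Nonempty := by
  obtain ⟨x, hx⟩ := hne
  obtain ⟨I, u, hu, huU⟩ := isOpen_pi_iff.1 hU x hx
  have : Nonempty Y := ⟨φ (x 0)⟩
  choose! y hy using fun i (hi : i ∈ I) => hso (u i) (hu i hi).1 ⟨x i, (hu i hi).2⟩
  refine ⟨y, mem_interior.2 ⟨(I : Set ℕ).pi fun i => interior (φ '' u i), fun z hz => ?_,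
    isOpen_set_pi I.finite_toSet fun i _ => isOpen_interior, fun i hi => hy i hi⟩⟩
  have : ∀ i, ∃ w, φ w = z i ∧ (i ∈ I → w ∈ u i) := fun i => by
    by_cases hi : i ∈ I
    · obtain ⟨w, hw, hwz⟩ := interior_subset (hz i hi)
      exact ⟨w, hwz, fun _ => hw⟩
    · obtain ⟨w, hw⟩ := hs (z i)
      exact ⟨w, hw, fun h => absurd h hi⟩
  choose w hw hwu using this
  exact ⟨w, huU fun i hi => hwu i hi, funext hw⟩

/-- Regrouping the coordinates of `ℤ^ℕ`. -/
def intSeqHomeo : (ℕ → ℤ) ≃ₜ (ℕ → ℕ → ℤ) where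
  toFun x i j := x (Nat.pair i j)
  invFun y n := y n.unpair.1 n.unpair.2
  left_inv x := by simp
  right_inv y := by simp
  continuous_toFun := by fun_prop
  continuous_invFun := by fun_prop

/-- There is a continuous semi-open bijection `Φ : ℤ^ℕ → I^ω` such that the image of
each coset `f + (ℤ \ {0})^ℕ` belongs to the σ-ideal `σC₀`. -/
theorem exists_semiopen_bijection_Baire_to_HilbertCube :
    ∃ Φ : (ℕ → ℤ) → HilbertCube, Continuous Φ ∧ Function.Bijective Φ ∧
      (∀ U : Set (ℕ → ℤ), IsOpen U → U.Nonempty → (interior (Φ '' U)).Nonempty) ∧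
      ∀ f : ℕ → ℤ,
        Φ '' {x | ∃ g : ℕ → ℤ, (∀ n, g n ≠ 0) ∧ x = f + g} ∈ sigmaC0 := by
  obtain ⟨φ, hc, hb, hso⟩ := exists_semiopen_bijection_int_seq
  refine ⟨fun x i => φ (intSeqHomeo x i), by fun_prop, ?_, fun U hU hne => ?_, fun f => ?_⟩
  · constructor
    · exact fun x y h => intSeqHomeo.injective (funext fun i => hb.1 (congrFun h i))
    · intro y
      choose z hz using fun i => hb.2 (y i)
      exact ⟨intSeqHomeo.symm z, by simp [hz]⟩
  · have := nonempty_interior_image_pi hb.2 hso (intSeqHomeo.isOpenMap U hU) (hne.image _)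
    rwa [image_image] at this
  · have hcl := fun i => interior_closure_image_eq_empty hc hb hso
      (isClosed_ne_int_seq (intSeqHomeo f i)) (interior_ne_int_seq_eq_empty (intSeqHomeo f i))
    obtain ⟨H, hH⟩ := exists_homeo_mem_standardCantorSet (fun _ => isClosed_closure) hcl
    refine ⟨fun _ => H ⁻¹' standardCantorSet,
      fun _ => isMinimalCantorSet_standardCantorSet.preimage H, ?_⟩
    rintro _ ⟨_, ⟨g, hg, rfl⟩, rfl⟩
    refine mem_iUnion.2 ⟨0, hH _ fun i => subset_closure ⟨_, fun n => ?_, rfl⟩⟩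
    change f (Nat.pair i n) + g (Nat.pair i n) ≠ f (Nat.pair i n)
    simpa using hg (Nat.pair i n)
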